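/- If a finite simple graph G is 1-HNG and has at least one vertex, then there exists a vertex v of G such that G − v is a perfect graph (i.e., G is apex-perfect). -/

import Mathlib

open SimpleGraph

/-- The chromatic number of `G` as a natural number. -/
noncomputable def chi {V : Type*} (G : SimpleGraph V) : ℕ := G.chromaticNumber.toNat

/-- The clique cover number of `G`: the chromatic number of the complement. -/
noncomputable def theta {V : Type*} (G : SimpleGraph V) : ℕ := chi Gᶜ

/-- `G` is `a`-hereditary-Nordhaus-Gaddum: every induced subgraph `H`
satisfies `χ(H) + θ(H) ≥ |H| + 1 - a`. -/
def IsHNG {V : Type*} [Fintype V] (G : SimpleGraph V) (a : ℕ) : Prop :=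
  ∀ s : Finset V, s.card + 1 - a ≤ chi (G.induce (s : Set V)) + theta (G.induce (s : Set V))

/-- `G` contains an induced copy of `H` if some induced subgraph of `G` is
isomorphic to `H`. -/
def HasInducedCopy {V W : Type*} (G : SimpleGraph V) (H : SimpleGraph W) : Prop :=
  ∃ s : Finset V, Nonempty ((G.induce (s : Set V)) ≃g H)

/-- `G` is perfect: every induced subgraph `H` satisfies `χ(H) = ω(H)`. -/
def IsPerfect {V : Type*} [Fintype V] (G : SimpleGraph V) : Prop :=
  ∀ s : Finset V, chi (G.induce (s : Set V)) = (G.induce (s : Set V)).cliqueNum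

/-! ### Colorings of finite vertex sets -/

/-- The subgraph of `G` induced on `s` has a proper coloring with `p` colors. -/
def ColorableOn {V : Type*} (G : SimpleGraph V) (s : Finset V) (p : ℕ) : Prop :=
  ∃ f : V → ℕ, (∀ x ∈ s, f x < p) ∧ ∀ x ∈ s, ∀ y ∈ s, G.Adj x y → f x ≠ f y

theorem colorableOn_iff {V : Type*} (G : SimpleGraph V) (s : Finset V) (p : ℕ) :
    ColorableOn G s p ↔ (G.induce (s : Set V)).Colorable p := by
  classical
  rw [colorable_iff_exists_bdd_nat_coloring]
  constructor
  · rintro ⟨f, hf, hG⟩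
    exact ⟨Coloring.mk (fun x => f x.1) (fun {x y} h => hG _ x.2 _ y.2 h), fun x => hf _ x.2⟩
  · rintro ⟨C, hC⟩
    refine ⟨fun x => if h : x ∈ s then C ⟨x, h⟩ else 0, ?_, ?_⟩
    · intro x hx
      simpa [hx] using hC ⟨x, hx⟩
    · intro x hx y hy h
      simpa [hx, hy] using C.valid (v := ⟨x, hx⟩) (w := ⟨y, hy⟩) h

theorem ColorableOn.mono {V : Type*} {G : SimpleGraph V} {s t : Finset V} {p q : ℕ}
    (h : ColorableOn G t p) (hst : s ⊆ t) (hpq : p ≤ q) : ColorableOn G s q := by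
  obtain ⟨f, hf, hG⟩ := h
  exact ⟨f, fun x hx => (hf x (hst hx)).trans_le hpq,
    fun x hx y hy => hG x (hst hx) y (hst hy)⟩

theorem chi_le_of_colorable {V : Type*} {G : SimpleGraph V} {p : ℕ} (h : G.Colorable p) :
    chi G ≤ p :=
  ENat.toNat_le_of_le_natCast h.chromaticNumber_le

theorem colorable_chi {V : Type*} [Finite V] (G : SimpleGraph V) : G.Colorable (chi G) :=
  colorable_chromaticNumber_of_fintype G

theorem induce_compl {V : Type*} (G : SimpleGraph V) (s : Set V) :
    (G.induce s)ᶜ = Gᶜ.induce s := by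
  ext x y
  simp [Subtype.ext_iff]

/-- Every finite induced subgraph on a set `s` satisfies `χ + θ ≥ |s|`. -/
def NordhausGaddumTight {V : Type*} (G : SimpleGraph V) : Prop :=
  ∀ (s : Finset V) (p q : ℕ), ColorableOn G s p → ColorableOn Gᶜ s q → s.card ≤ p + q

theorem NordhausGaddumTight.compl {V : Type*} {G : SimpleGraph V} (h : NordhausGaddumTight G) :
    NordhausGaddumTight Gᶜ := by
  intro s p q hp hq
  rw [compl_compl] at hq
  rw [add_comm]
  exact h s q p hq hp

theorem IsHNG.nordhausGaddumTight {V : Type*} [Fintype V] {G : SimpleGraph V} (h : IsHNG G 1) :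
    NordhausGaddumTight G := by
  intro s p q hp hq
  rw [colorableOn_iff] at hp hq
  rw [← induce_compl] at hq
  have h₁ := h s
  have h₂ := chi_le_of_colorable hp
  have h₃ : theta (G.induce (s : Set V)) ≤ q := chi_le_of_colorable hq
  lia

/-- `χ = ω` for the subgraph of `G` induced on `s`. -/
def GoodOn {V : Type*} (G : SimpleGraph V) (s : Finset V) : Prop :=
  ∃ K ⊆ s, G.IsClique (K : Set V) ∧ ColorableOn G s K.card

theorem GoodOn.chi_eq_cliqueNum {V : Type*} {G : SimpleGraph V} {s : Finset V}
    (h : GoodOn G s) : chi (G.induce (s : Set V)) = (G.induce (s : Set V)).cliqueNum := by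
  classical
  obtain ⟨K, hKs, hK, hcol⟩ := h
  rw [colorableOn_iff] at hcol
  have hKc : (G.induce (s : Set V)).IsClique (K.subtype (· ∈ s) : Finset s) := by
    intro x hx y hy hxy
    exact hK (Finset.mem_subtype.1 hx) (Finset.mem_subtype.1 hy) (fun e => hxy (Subtype.ext e))
  have hcard : (K.subtype (· ∈ s)).card = K.card := by
    rw [Finset.card_subtype, Finset.filter_true_of_mem hKs]
  apply le_antisymm
  · exact (chi_le_of_colorable hcol).trans (hcard ▸ IsClique.card_le_cliqueNum (tc := hKc))
  · obtain ⟨L, hL⟩ := (G.induce (s : Set V)).exists_isNClique_cliqueNum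
    rw [← hL.card_eq]
    exact hL.isClique.card_le_of_colorable (colorable_chi _)

theorem isPerfect_induce_of_goodOn {V : Type*} [Fintype V] [DecidableEq V] {G : SimpleGraph V}
    (v : V) (h : ∀ s : Finset V, v ∉ s → GoodOn G s) :
    IsPerfect (G.induce ({v}ᶜ : Set V)) := by
  intro s
  apply GoodOn.chi_eq_cliqueNum
  obtain ⟨K, hKs, hK, f, hf, hG⟩ := h (s.map (Function.Embedding.subtype _)) (by simp)
  have hv : ∀ x ∈ K, x ∈ ({v}ᶜ : Set V) := by
    intro x hx
    obtain ⟨y, -, rfl⟩ := Finset.mem_map.1 (hKs hx)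
    exact y.2
  have hcard : (K.subtype (· ∈ ({v}ᶜ : Set V))).card = K.card := by
    rw [Finset.card_subtype, Finset.filter_true_of_mem hv]
  refine ⟨K.subtype (· ∈ ({v}ᶜ : Set V)), ?_, ?_, fun x => f x.1, ?_, ?_⟩
  · intro x hx
    have := hKs (Finset.mem_subtype.1 hx)
    simp only [Finset.mem_map, Function.Embedding.subtype_apply] at this
    obtain ⟨y, hy, hyx⟩ := this
    rwa [← Subtype.ext hyx]
  · intro x hx y hy hxy
    exact hK (Finset.mem_subtype.1 hx) (Finset.mem_subtype.1 hy) (fun e => hxy (Subtype.ext e))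
  · intro x hx
    rw [hcard]
    exact hf _ (Finset.mem_map_of_mem _ hx)
  · intro x hx y hy hxy
    exact hG _ (Finset.mem_map_of_mem _ hx) _ (Finset.mem_map_of_mem _ hy) hxy

/-! ### Minimal imperfect vertex sets -/

theorem ColorableOn.of_sdiff_indep {V : Type*} [DecidableEq V] {G : SimpleGraph V}
    {s A : Finset V} {p : ℕ} (h : ColorableOn G (s \ A) p)
    (hA : ∀ x ∈ A, ∀ y ∈ A, ¬G.Adj x y) : ColorableOn G s (p + 1) := by
  obtain ⟨f, hf, hG⟩ := h
  refine ⟨fun x => if x ∈ A then p else f x, fun x hx => ?_, fun x hx y hy hxy => ?_⟩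
  · by_cases h : x ∈ A
    · simp [h]
    · simpa [h] using (hf x (by simp [hx, h])).trans (Nat.lt_succ_self p)
  · by_cases hxA : x ∈ A <;> by_cases hyA : y ∈ A
    · exact absurd hxy (hA x hxA y hyA)
    · simpa [hxA, hyA] using (hf y (by simp [hy, hyA])).ne'
    · simpa [hxA, hyA] using (hf x (by simp [hx, hxA])).ne
    · simpa [hxA, hyA] using hG x (by simp [hx, hxA]) y (by simp [hy, hyA]) hxy

theorem exists_maximum_clique {V : Type*} (G : SimpleGraph V) (s : Finset V) :
    ∃ K ⊆ s, G.IsClique (K : Set V) ∧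
      ∀ L ⊆ s, G.IsClique (L : Set V) → L.card ≤ K.card := by
  classical
  obtain ⟨K, hK, hmax⟩ :=
    (s.powerset.filter fun K : Finset V => G.IsClique (K : Set V)).exists_max_image
    Finset.card ⟨∅, by simp⟩
  simp only [Finset.mem_filter, Finset.mem_powerset] at hK hmax
  exact ⟨K, hK.1, hK.2, fun L hL hL' => hmax L ⟨hL, hL'⟩⟩

/-- If sets `A i` and subsets `K i` of `t` meet in one element for distinct indices and not at all
for equal indices, then there are at most `|t|` indices. -/
theorem card_le_of_card_inter_eq {V ι : Type*} [DecidableEq V] [Fintype ι] [DecidableEq ι]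
    (t : Finset V) (A K : ι → Finset V) (hK : ∀ i, K i ⊆ t)
    (h₀ : ∀ i, (A i ∩ K i).card = 0) (h₁ : ∀ i j, i ≠ j → (A i ∩ K j).card = 1)
    (hι : Fintype.card ι ≠ 1) : Fintype.card ι ≤ t.card := by
  have hli : LinearIndependent ℚ (fun i (y : t) => if y.1 ∈ A i then (1 : ℚ) else 0) := by
    rw [Fintype.linearIndependent_iff]
    intro c hc
    have hpair : ∀ i j, (∑ y : t, if y.1 ∈ K j then (if y.1 ∈ A i then (1 : ℚ) else 0) else 0)
        = if i = j then 0 else 1 := by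
      intro i j
      have : (∑ y : t, if y.1 ∈ K j then (if y.1 ∈ A i then (1 : ℚ) else 0) else 0)
          = ((A i ∩ K j).card : ℚ) := by
        rw [Finset.sum_coe_sort t
          (fun y => if y ∈ K j then (if y ∈ A i then (1 : ℚ) else 0) else 0)]
        simp_rw [← ite_and]
        rw [Finset.sum_boole]
        congr 2
        ext y
        simp only [Finset.mem_filter, Finset.mem_inter]
        exact ⟨fun h => ⟨h.2.2, h.2.1⟩, fun h => ⟨hK j h.2, h.2, h.1⟩⟩
      rw [this]
      split_ifs with hij
      · subst hij
        simp [h₀]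
      · simp [h₁ i j hij]
    have hsum : ∀ j, c j = ∑ i, c i := by
      intro j
      have hz : ∑ y : t, (if y.1 ∈ K j then
          (∑ i, c i • fun y : t => if y.1 ∈ A i then (1 : ℚ) else 0) y else 0) = 0 := by
        rw [hc]
        simp
      have : ∑ i, c i * (if i = j then 0 else 1) = 0 := by
        refine Eq.trans ?_ hz
        rw [Finset.sum_congr rfl fun i _ => by rw [← hpair i j, Finset.mul_sum], Finset.sum_comm]
        refine Finset.sum_congr rfl fun y _ => ?_
        split_ifs <;> simp
      have h2 : ∑ i, c i * (if i = j then 0 else 1) = ∑ i, (c i - if i = j then c i else 0) :=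
        Finset.sum_congr rfl fun i _ => by split_ifs <;> simp
      rw [h2, Finset.sum_sub_distrib, Finset.sum_ite_eq' Finset.univ j c] at this
      simp at this
      linarith
    have hS : ∑ i, c i = Fintype.card ι * ∑ i, c i := by
      conv_lhs => rw [Finset.sum_congr rfl fun i _ => hsum i]
      simp
    have hne : (Fintype.card ι : ℚ) - 1 ≠ 0 := by
      rw [sub_ne_zero]
      exact_mod_cast hι
    intro i
    rw [hsum i]
    have : ((Fintype.card ι : ℚ) - 1) * ∑ i, c i = 0 := by linarith
    exact (mul_eq_zero.1 this).resolve_left hne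
  simpa using hli.fintype_card_le_finrank

/-- Lovász's bound: a minimal imperfect vertex set has more than `α * ω` vertices. -/
theorem mul_card_lt_card_of_minimal {V : Type*} [DecidableEq V] {G : SimpleGraph V}
    {t K S : Finset V} (hbad : ¬GoodOn G t) (hmin : ∀ u ⊂ t, GoodOn G u)
    (hK : K ⊆ t) (hKc : G.IsClique (K : Set V))
    (hKmax : ∀ L ⊆ t, G.IsClique (L : Set V) → L.card ≤ K.card)
    (hS : S ⊆ t) (hSi : ∀ x ∈ S, ∀ y ∈ S, ¬G.Adj x y) (hpos : S.card * K.card ≠ 0) :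
    S.card * K.card < t.card := by
  have hnot : ¬ColorableOn G t K.card := fun h => hbad ⟨K, hK, hKc, h⟩
  have hcol : ∀ u ⊂ t, ColorableOn G u K.card := by
    intro u hu
    obtain ⟨L, hL, hLc, h⟩ := hmin u hu
    exact h.mono subset_rfl (hKmax L (hL.trans hu.1) hLc)
  have hmiss : ∀ A ⊆ t, (∀ x ∈ A, ∀ y ∈ A, ¬G.Adj x y) →
      ∃ L ⊆ t, Disjoint A L ∧ G.IsClique (L : Set V) ∧ L.card = K.card := by
    intro A hA hAi
    rcases A.eq_empty_or_nonempty with rfl | ⟨a, ha⟩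
    · exact ⟨K, hK, by simp, hKc, rfl⟩
    · obtain ⟨L, hL, hLc, h⟩ := hmin (t \ A) (Finset.sdiff_ssubset hA ⟨a, ha⟩)
      have hLt := hL.trans Finset.sdiff_subset
      refine ⟨L, hLt, ?_, hLc, le_antisymm (hKmax L hLt hLc) ?_⟩
      · exact Finset.disjoint_of_subset_right hL Finset.disjoint_sdiff
      · by_contra! hlt
        exact hnot ((h.of_sdiff_indep hAi).mono subset_rfl hlt)
  have hcolS : ∀ a : S, ∃ f : V → ℕ, (∀ x ∈ t.erase a, f x < K.card) ∧
      ∀ x ∈ t.erase a, ∀ y ∈ t.erase a, G.Adj x y → f x ≠ f y :=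
    fun a => hcol _ (Finset.erase_ssubset (hS a.2))
  choose f hf hfG using hcolS
  let A : Option (S × Fin K.card) → Finset V := fun i =>
    i.elim S fun ac => (t.erase ac.1).filter fun x => f ac.1 x = ac.2
  have hAt : ∀ i, A i ⊆ t := by
    rintro (_ | ⟨a, c⟩)
    · exact hS
    · exact (Finset.filter_subset _ _).trans (Finset.erase_subset _ _)
  have hAi : ∀ i, ∀ x ∈ A i, ∀ y ∈ A i, ¬G.Adj x y := by
    rintro (_ | ⟨a, c⟩)
    · exact hSi
    · intro x hx y hy hxy
      simp only [A, Option.elim_some, Finset.mem_filter] at hx hy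
      exact hfG a x hx.1 y hy.1 hxy (hx.2.trans hy.2.symm)
  choose L hLt hLd hLc hLcard using fun i => hmiss (A i) (hAt i) (hAi i)
  have hle : ∀ i j, (A i ∩ L j).card ≤ 1 := by
    intro i j
    rw [Finset.card_le_one]
    intro x hx y hy
    by_contra hne
    rw [Finset.mem_inter] at hx hy
    exact hAi i x hx.1 y hy.1 (hLc j hx.2 hy.2 hne)
  have htotal : ∀ j, ∑ i, (A i ∩ L j).card = S.card * K.card := by
    intro j
    have hfib : ∀ a : S, ∑ c, (A (some (a, c)) ∩ L j).card = ((L j).erase a).card := by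
      intro a
      rw [Finset.card_eq_sum_card_fiberwise (s := (L j).erase a) (f := f a)
        (t := Finset.range K.card)]
      · rw [← Fin.sum_univ_eq_sum_range
          (fun c => (((L j).erase a).filter fun x => f a x = c).card)]
        refine Finset.sum_congr rfl fun c _ => ?_
        congr 1
        ext x
        simp only [A, Option.elim_some, Finset.mem_inter, Finset.mem_filter, Finset.mem_erase]
        constructor
        · rintro ⟨⟨⟨h1, -⟩, h2⟩, h3⟩
          exact ⟨⟨h1, h3⟩, h2⟩
        · rintro ⟨⟨h1, h3⟩, h2⟩
          exact ⟨⟨⟨h1, hLt j h3⟩, h2⟩, h3⟩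
      · intro x hx
        have hx' := Finset.mem_erase.1 (Finset.mem_coe.1 hx)
        simpa using hf a x (Finset.mem_erase.2 ⟨hx'.1, hLt j hx'.2⟩)
    rw [Fintype.sum_option, Fintype.sum_prod_type, Finset.sum_congr rfl fun a _ => hfib a]
    have hA0 : (A none ∩ L j).card = ∑ a : S, if a.1 ∈ L j then 1 else 0 := by
      rw [Finset.sum_coe_sort S (fun a => if a ∈ L j then 1 else 0), Finset.sum_boole,
        Finset.filter_mem_eq_inter]
      rfl
    rw [hA0, ← Finset.sum_add_distrib]
    have hterm : ∀ a : S, (if a.1 ∈ L j then 1 else 0) + ((L j).erase a).card = K.card := by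
      intro a
      split_ifs with h
      · rw [add_comm, Finset.card_erase_add_one h, hLcard]
      · rw [Finset.erase_eq_of_notMem h, hLcard, zero_add]
    rw [Finset.sum_congr rfl fun a _ => hterm a]
    simp
  have hcardι : Fintype.card (Option (S × Fin K.card)) = S.card * K.card + 1 := by simp
  have h₀ : ∀ i, (A i ∩ L i).card = 0 := fun i =>
    Finset.card_eq_zero.2 (Finset.disjoint_iff_inter_eq_empty.1 (hLd i))
  have h₁ : ∀ i j, i ≠ j → (A i ∩ L j).card = 1 := by
    intro i j hij
    by_contra hne
    have hzero : (A i ∩ L j).card = 0 := by have := hle i j; lia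
    have hsum : ∑ k ∈ Finset.univ \ {i, j}, (A k ∩ L j).card = S.card * K.card := by
      rw [← htotal j]
      apply Finset.sum_subset (Finset.subset_univ _)
      intro k _ hk
      simp only [Finset.mem_sdiff, Finset.mem_univ, true_and, not_not, Finset.mem_insert,
        Finset.mem_singleton] at hk
      rcases hk with rfl | rfl
      · exact hzero
      · exact h₀ _
    have hbound : ∑ k ∈ Finset.univ \ {i, j}, (A k ∩ L j).card
        ≤ (Finset.univ \ {i, j}).card * 1 := Finset.sum_le_card_nsmul _ _ _ fun k _ => hle k j
    rw [Finset.card_sdiff_of_subset (Finset.subset_univ _), Finset.card_pair hij,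
      Finset.card_univ, hcardι] at hbound
    lia
  have := card_le_of_card_inter_eq t A L hLt h₀ h₁ (by rw [hcardι]; lia)
  lia

/-! ### Pentagons -/

/-- `a, b, c, d, e` is an induced five-cycle of `G`, in this cyclic order. -/
structure InducedPentagon {V : Type*} (G : SimpleGraph V) (a b c d e : V) : Prop where
  ab : G.Adj a b
  bc : G.Adj b c
  cd : G.Adj c d
  de : G.Adj d e
  ea : G.Adj e a
  nac : ¬G.Adj a c
  nbd : ¬G.Adj b d
  nce : ¬G.Adj c e
  nda : ¬G.Adj d a
  neb : ¬G.Adj e b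

namespace InducedPentagon

variable {V : Type*} {G : SimpleGraph V} {a b c d e : V}

theorem rotate (h : InducedPentagon G a b c d e) : InducedPentagon G b c d e a :=
  ⟨h.bc, h.cd, h.de, h.ea, h.ab, h.nbd, h.nce, h.nda, h.neb, h.nac⟩

theorem reverse (h : InducedPentagon G a b c d e) : InducedPentagon G a e d c b :=
  ⟨h.ea.symm, h.de.symm, h.cd.symm, h.bc.symm, h.ab.symm, fun k => h.nda k.symm,
    fun k => h.nce k.symm, fun k => h.nbd k.symm, fun k => h.nac k.symm, fun k => h.neb k.symm⟩

theorem nodup (h : InducedPentagon G a b c d e) : [a, b, c, d, e].Nodup := by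
  have hac : a ≠ c := by rintro rfl; exact h.nda h.cd.symm
  have hbd : b ≠ d := by rintro rfl; exact h.neb h.de.symm
  have hce : c ≠ e := by rintro rfl; exact h.nac h.ea.symm
  have had : a ≠ d := by rintro rfl; exact h.nac h.cd.symm
  have hbe : b ≠ e := by rintro rfl; exact h.nbd h.de.symm
  simp [h.ab.ne, h.bc.ne, h.cd.ne, h.de.ne, h.ea.ne.symm, hac, hbd, hce, had, hbe]

theorem compl (h : InducedPentagon G a b c d e) : InducedPentagon Gᶜ a c e b d := by
  have := h.nodup
  simp only [List.nodup_cons, List.mem_cons, List.not_mem_nil, or_false, not_or] at this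
  obtain ⟨⟨-, hac, had, -⟩, ⟨-, hbd, hbe⟩, ⟨-, hce⟩, -⟩ := this
  exact
    { ab := ⟨hac, h.nac⟩
      bc := ⟨hce, h.nce⟩
      cd := ⟨Ne.symm hbe, h.neb⟩
      de := ⟨hbd, h.nbd⟩
      ea := ⟨Ne.symm had, h.nda⟩
      nac := fun k => k.2 h.ea.symm
      nbd := fun k => k.2 h.bc.symm
      nce := fun k => k.2 h.de.symm
      nda := fun k => k.2 h.ab.symm
      neb := fun k => k.2 h.cd.symm }

end InducedPentagon

/-- The subgraph of `G` induced on `t` is a five-cycle. -/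
def IsPentagon {V : Type*} [DecidableEq V] (G : SimpleGraph V) (t : Finset V) : Prop :=
  ∃ a b c d e, InducedPentagon G a b c d e ∧ t = {a, b, c, d, e}

namespace IsPentagon

variable {V : Type*} [DecidableEq V] {G : SimpleGraph V} {t : Finset V}

theorem card_eq (h : IsPentagon G t) : t.card = 5 := by
  obtain ⟨a, b, c, d, e, h, rfl⟩ := h
  have : ({a, b, c, d, e} : Finset V) = [a, b, c, d, e].toFinset := by simp
  rw [this, List.toFinset_card_of_nodup h.nodup]
  rfl

theorem compl (h : IsPentagon G t) : IsPentagon Gᶜ t := by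
  obtain ⟨a, b, c, d, e, h, rfl⟩ := h
  refine ⟨_, _, _, _, _, h.compl, ?_⟩
  ext x
  simp only [Finset.mem_insert, Finset.mem_singleton]
  tauto

theorem compl_iff : IsPentagon Gᶜ t ↔ IsPentagon G t :=
  ⟨fun h => by simpa using h.compl, compl⟩

theorem exists_of_mem (h : IsPentagon G t) {v : V} (hv : v ∈ t) :
    ∃ a b c d, InducedPentagon G v a b c d ∧ t = {v, a, b, c, d} := by
  obtain ⟨a, b, c, d, e, h, rfl⟩ := h
  simp only [Finset.mem_insert, Finset.mem_singleton] at hv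
  rcases hv with rfl | rfl | rfl | rfl | rfl
  · exact ⟨_, _, _, _, h, rfl⟩
  · exact ⟨_, _, _, _, h.rotate, by ext; simp only [Finset.mem_insert, Finset.mem_singleton]; tauto⟩
  · exact ⟨_, _, _, _, h.rotate.rotate,
      by ext; simp only [Finset.mem_insert, Finset.mem_singleton]; tauto⟩
  · exact ⟨_, _, _, _, h.rotate.rotate.rotate,
      by ext; simp only [Finset.mem_insert, Finset.mem_singleton]; tauto⟩
  · exact ⟨_, _, _, _, h.rotate.rotate.rotate.rotate,
      by ext; simp only [Finset.mem_insert, Finset.mem_singleton]; tauto⟩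

theorem exists_of_adj (h : IsPentagon G t) {v w : V} (hv : v ∈ t) (hw : w ∈ t)
    (hvw : G.Adj v w) :
    ∃ b c d, InducedPentagon G v w b c d ∧ t = {v, w, b, c, d} := by
  obtain ⟨a, b, c, d, hp, rfl⟩ := h.exists_of_mem hv
  simp only [Finset.mem_insert, Finset.mem_singleton] at hw
  rcases hw with rfl | rfl | rfl | rfl | rfl
  · exact absurd hvw (G.loopless.irrefl _)
  · exact ⟨_, _, _, hp, rfl⟩
  · exact absurd hvw hp.nac
  · exact absurd hvw.symm hp.nda
  · exact ⟨_, _, _, hp.reverse,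
      by ext; simp only [Finset.mem_insert, Finset.mem_singleton]; tauto⟩

/-- A pentagon has no triangle. -/
theorem not_triangle (h : IsPentagon G t) {x y z : V} (hx : x ∈ t) (hy : y ∈ t) (hz : z ∈ t)
    (hxy : G.Adj x y) (hxz : G.Adj x z) (hyz : G.Adj y z) : False := by
  obtain ⟨b, c, d, hp, rfl⟩ := h.exists_of_adj hx hy hxy
  simp only [Finset.mem_insert, Finset.mem_singleton] at hz
  rcases hz with rfl | rfl | rfl | rfl | rfl
  · exact G.loopless.irrefl _ hxz
  · exact G.loopless.irrefl _ hyz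
  · exact hp.nac hxz
  · exact hp.nbd hyz
  · exact hp.neb hyz.symm

theorem of_card_le_two (ht : t.card = 5)
    (hω : ∀ K ⊆ t, G.IsClique (K : Set V) → K.card ≤ 2)
    (hα : ∀ K ⊆ t, Gᶜ.IsClique (K : Set V) → K.card ≤ 2) : IsPentagon G t := by
  have tri : ∀ (H : SimpleGraph V), (∀ K ⊆ t, H.IsClique (K : Set V) → K.card ≤ 2) →
      ∀ x ∈ t, ∀ y ∈ t, ∀ z ∈ t, H.Adj x y → H.Adj x z → H.Adj y z → False := by
    intro H hH x hx y hy z hz hxy hxz hyz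
    have h3 : H.IsNClique 3 {x, y, z} := is3Clique_triple_iff.2 ⟨hxy, hxz, hyz⟩
    have := hH {x, y, z} (by simp [Finset.insert_subset_iff, hx, hy, hz]) h3.isClique
    rw [h3.card_eq] at this
    lia
  have hadj := tri G hω
  have hnon := tri Gᶜ hα
  obtain ⟨v, hv⟩ : t.Nonempty := Finset.card_pos.1 (by lia)
  classical
  have hN : ((t.erase v).filter fun x => G.Adj v x).card ≤ 2 := by
    refine hα _ ((Finset.filter_subset _ _).trans (Finset.erase_subset _ _)) ?_
    intro x hx y hy hxy
    simp only [Finset.coe_filter, Finset.mem_erase, Set.mem_ofPred_eq] at hx hy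
    exact ⟨hxy, hadj v hv x hx.1.2 y hy.1.2 hx.2 hy.2⟩
  have hM : ((t.erase v).filter fun x => ¬G.Adj v x).card ≤ 2 := by
    refine hω _ ((Finset.filter_subset _ _).trans (Finset.erase_subset _ _)) ?_
    intro x hx y hy hxy
    simp only [Finset.coe_filter, Finset.mem_erase, Set.mem_ofPred_eq] at hx hy
    by_contra hn
    exact hnon v hv x hx.1.2 y hy.1.2 ⟨Ne.symm hx.1.1, hx.2⟩ ⟨Ne.symm hy.1.1, hy.2⟩ ⟨hxy, hn⟩
  have hsum := Finset.card_filter_add_card_filter_not (s := t.erase v) (fun x => G.Adj v x)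
  rw [Finset.card_erase_of_mem hv] at hsum
  obtain ⟨a, b, hab, hNab⟩ := Finset.card_eq_two.1
    (show ((t.erase v).filter fun x => G.Adj v x).card = 2 by lia)
  obtain ⟨c, d, hcd, hMcd⟩ := Finset.card_eq_two.1
    (show ((t.erase v).filter fun x => ¬G.Adj v x).card = 2 by lia)
  have hteq : t = {v, a, b, c, d} := by
    rw [← Finset.insert_erase hv, ← Finset.filter_union_filter_not_eq (fun x => G.Adj v x)
      (t.erase v), hNab, hMcd]
    ext
    simp only [Finset.mem_insert, Finset.mem_singleton, Finset.mem_union]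
    tauto
  have ha : a ∈ (t.erase v).filter fun x => G.Adj v x := by simp [hNab]
  have hb : b ∈ (t.erase v).filter fun x => G.Adj v x := by simp [hNab]
  have hc : c ∈ (t.erase v).filter fun x => ¬G.Adj v x := by simp [hMcd]
  have hd : d ∈ (t.erase v).filter fun x => ¬G.Adj v x := by simp [hMcd]
  simp only [Finset.mem_filter, Finset.mem_erase] at ha hb hc hd
  obtain ⟨⟨hav, hat⟩, hva⟩ := ha
  obtain ⟨⟨hbv, hbt⟩, hvb⟩ := hb
  obtain ⟨⟨hcv, hct⟩, hvc⟩ := hc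
  obtain ⟨⟨hdv, hdt⟩, hvd⟩ := hd
  have hac : a ≠ c := by rintro rfl; exact hvc hva
  have had : a ≠ d := by rintro rfl; exact hvd hva
  have hbc : b ≠ c := by rintro rfl; exact hvc hvb
  have hbd : b ≠ d := by rintro rfl; exact hvd hvb
  have nab : ¬G.Adj a b := hadj v hv a hat b hbt hva hvb
  have acd : G.Adj c d := by
    by_contra h
    exact hnon v hv c hct d hdt ⟨Ne.symm hcv, hvc⟩ ⟨Ne.symm hdv, hvd⟩ ⟨hcd, h⟩
  have na : ¬(G.Adj a c ∧ G.Adj a d) := fun h => hadj a hat c hct d hdt h.1 h.2 acd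
  have nb : ¬(G.Adj b c ∧ G.Adj b d) := fun h => hadj b hbt c hct d hdt h.1 h.2 acd
  have hc' : G.Adj a c ∨ G.Adj b c := by
    by_contra! h
    exact hnon a hat b hbt c hct ⟨hab, nab⟩ ⟨hac, h.1⟩ ⟨hbc, h.2⟩
  have hd' : G.Adj a d ∨ G.Adj b d := by
    by_contra! h
    exact hnon a hat b hbt d hdt ⟨hab, nab⟩ ⟨had, h.1⟩ ⟨hbd, h.2⟩
  by_cases h : G.Adj a c
  · have h1 : ¬G.Adj a d := fun k => na ⟨h, k⟩
    have h2 : G.Adj b d := hd'.resolve_left h1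
    have h3 : ¬G.Adj b c := fun k => nb ⟨k, h2⟩
    refine ⟨v, a, c, d, b, ⟨hva, h, acd, h2.symm, hvb.symm, hvc, h1, fun k => h3 k.symm,
      fun k => hvd k.symm, fun k => nab k.symm⟩, ?_⟩
    rw [hteq]
    ext
    simp only [Finset.mem_insert, Finset.mem_singleton]
    tauto
  · have h2 : G.Adj b c := hc'.resolve_left h
    have h3 : ¬G.Adj b d := fun k => nb ⟨h2, k⟩
    have h1 : G.Adj a d := hd'.resolve_right h3
    refine ⟨v, a, d, c, b, ⟨hva, h1, acd.symm, h2.symm, hvb.symm, hvd, h, fun k => h3 k.symm,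
      fun k => hvc k.symm, fun k => nab k.symm⟩, ?_⟩
    rw [hteq]
    ext
    simp only [Finset.mem_insert, Finset.mem_singleton]
    tauto

end IsPentagon

theorem isPentagon_of_minimal_of_not_goodOn {V : Type*} [DecidableEq V] {G : SimpleGraph V}
    (hG : NordhausGaddumTight G) {t : Finset V} (hbad : ¬GoodOn G t)
    (hmin : ∀ u ⊂ t, GoodOn G u ∧ GoodOn Gᶜ u) : IsPentagon G t := by
  obtain ⟨K, hK, hKc, hKmax⟩ := exists_maximum_clique G t
  obtain ⟨S, hS, hSc, hSmax⟩ := exists_maximum_clique Gᶜ t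
  obtain ⟨v, hv⟩ : t.Nonempty := by
    rw [Finset.nonempty_iff_ne_empty]
    rintro rfl
    exact hbad ⟨∅, subset_rfl, by simp, fun _ => 0, by simp, by simp⟩
  have hsub := Finset.erase_ssubset hv
  have hcard : t.card ≤ K.card + S.card + 1 := by
    obtain ⟨⟨L, hL, hLc, hLcol⟩, M, hM, hMc, hMcol⟩ := hmin _ hsub
    have := hG _ _ _ hLcol hMcol
    rw [Finset.card_erase_of_mem hv] at this
    have := hKmax L (hL.trans hsub.1) hLc
    have := hSmax M (hM.trans hsub.1) hMc
    lia
  have hK2 : 2 ≤ K.card := by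
    by_contra! hlt
    have hone : 1 ≤ K.card := by simpa using hKmax {v} (by simpa using hv) (by simp)
    refine hbad ⟨K, hK, hKc, fun _ => 0, fun _ _ => hone, fun x hx y hy hxy => ?_⟩
    have := hKmax {x, y} (by simp [Finset.insert_subset_iff, hx, hy])
      (by simpa [isClique_pair] using fun _ => hxy)
    rw [Finset.card_pair hxy.ne] at this
    lia
  have hS2 : 2 ≤ S.card := by
    by_contra! hlt
    refine hbad ⟨t, subset_rfl, ?_, ?_⟩
    · intro x hx y hy hxy
      by_contra hn
      have := hSmax {x, y} (Finset.insert_subset hx (by simpa using hy))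
        (by rw [Finset.coe_pair, isClique_pair]; exact fun _ => ⟨hxy, hn⟩)
      rw [Finset.card_pair hxy] at this
      lia
    · rw [colorableOn_iff]
      simpa using (G.induce (t : Set V)).colorable_of_fintype
  have hSi : ∀ x ∈ S, ∀ y ∈ S, ¬G.Adj x y := fun x hx y hy hxy =>
    (hSc hx hy hxy.ne).2 hxy
  have hlow := mul_card_lt_card_of_minimal hbad (fun u hu => (hmin u hu).1) hK hKc hKmax hS hSi
    (by positivity)
  have hK' : K.card = 2 := by nlinarith
  have hS' : S.card = 2 := by nlinarith
  rw [hK', hS'] at hlow hcard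
  exact IsPentagon.of_card_le_two (by lia) (fun L hL h => hK' ▸ hKmax L hL h)
    (fun L hL h => hS' ▸ hSmax L hL h)

theorem exists_isPentagon_of_not_goodOn {V : Type*} [DecidableEq V] {G : SimpleGraph V}
    (hG : NordhausGaddumTight G) {t : Finset V} (hbad : ¬GoodOn G t) :
    ∃ u ⊆ t, IsPentagon G u := by
  obtain ⟨u, hu, hmin⟩ := exists_minimal_le_of_wellFoundedLT
    (fun s => ¬(GoodOn G s ∧ GoodOn Gᶜ s)) t (fun h => hbad h.1)
  refine ⟨u, hu, ?_⟩
  have hmin' : ∀ w ⊂ u, GoodOn G w ∧ GoodOn Gᶜ w := fun w hw => by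
    by_contra h
    exact hw.2 (hmin.2 h hw.1)
  by_cases h : GoodOn G u
  · rw [← IsPentagon.compl_iff]
    refine isPentagon_of_minimal_of_not_goodOn hG.compl (fun k => hmin.1 ⟨h, k⟩) fun w hw => ?_
    rw [compl_compl]
    exact (hmin' w hw).symm
  · exact isPentagon_of_minimal_of_not_goodOn hG h hmin'

/-! ### Certificates of violation

A partially specified graph that violates `χ + θ ≥ |·|` on some vertex set in each of its
completions is refuted by a decision tree whose leaves carry a set, covered by too few independent
sets and cliques together. -/

theorem colorableOn_of_cover {V : Type*} {G : SimpleGraph V} {s : Finset V} (P : List (List V))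
    (hP : ∀ L ∈ P, ∀ x ∈ L, ∀ y ∈ L, ¬G.Adj x y) (hs : ∀ x ∈ s, ∃ L ∈ P, x ∈ L) :
    ColorableOn G s P.length := by
  classical
  have hlt : ∀ x ∈ s, P.findIdx (fun L => x ∈ L) < P.length := fun x hx => by
    simpa [List.findIdx_lt_length] using hs x hx
  refine ⟨fun x => P.findIdx (fun L => x ∈ L), hlt, fun x hx y hy hxy h => ?_⟩
  have hmem : ∀ z (hz : z ∈ s), z ∈ P[P.findIdx (fun L => z ∈ L)]'(hlt z hz) := fun z hz => by
    simpa using List.findIdx_getElem (p := fun L => decide (z ∈ L)) (w := hlt z hz)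
  have hxm := hmem x hx
  have hym := hmem y hy
  simp only [h] at hxm
  exact hP _ (List.getElem_mem _) x hxm y hym hxy

/-- A decision tree on the adjacency of pairs of labels; a leaf lists independent sets and
cliques. -/
inductive Refutation (ι : Type*)
  | leaf (P Q : List (List ι))
  | branch (u v : ι) (yes no : Refutation ι)

namespace Refutation

variable {ι : Type*} [DecidableEq ι]

/-- Validity of a decision tree, relative to lists of known edges and known nonedges. -/
def check : Refutation ι → List (ι × ι) → List (ι × ι) → Bool
  | leaf P Q, E, N => decide (Q.flatten.Nodup ∧ (∀ i ∈ Q.flatten, i ∈ P.flatten) ∧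
      (∀ L ∈ P, ∀ i ∈ L, ∀ j ∈ L, i = j ∨ (i, j) ∈ N ∨ (j, i) ∈ N) ∧
      (∀ L ∈ Q, ∀ i ∈ L, ∀ j ∈ L, i = j ∨ (i, j) ∈ E ∨ (j, i) ∈ E) ∧
      P.length + Q.length < Q.flatten.length)
  | branch u v yes no, E, N => yes.check ((u, v) :: E) N && no.check E ((u, v) :: N)

theorem not_check {V : Type*} {G : SimpleGraph V} (hG : NordhausGaddumTight G) {f : ι → V}
    (hf : Function.Injective f) (t : Refutation ι) {E N : List (ι × ι)}
    (hE : ∀ e ∈ E, G.Adj (f e.1) (f e.2)) (hN : ∀ e ∈ N, ¬G.Adj (f e.1) (f e.2)) :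
    ¬t.check E N := by
  classical
  induction t generalizing E N with
  | branch u v yes no hyes hno =>
    simp only [check, Bool.and_eq_true, not_and_or]
    by_cases h : G.Adj (f u) (f v)
    · exact .inl (hyes (List.forall_mem_cons.2 ⟨h, hE⟩) hN)
    · exact .inr (hno hE (List.forall_mem_cons.2 ⟨h, hN⟩))
  | leaf P Q =>
    simp only [check, decide_eq_true_eq]
    rintro ⟨hnd, hcov, hP, hQ, hlt⟩
    have h := hG (Q.flatten.map f).toFinset (P.map (List.map f)).length
      (Q.map (List.map f)).length (colorableOn_of_cover _ ?_ ?_) (colorableOn_of_cover _ ?_ ?_)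
    · rw [List.toFinset_card_of_nodup (hnd.map hf)] at h
      simp only [List.length_map] at h
      lia
    · simp only [List.forall_mem_map]
      intro L hL i hi j hj hij
      rcases hP L hL i hi j hj with rfl | h | h
      · exact hij.ne rfl
      · exact hN _ h hij
      · exact hN _ h hij.symm
    · simp only [List.mem_toFinset, List.forall_mem_map]
      intro i hi
      obtain ⟨L, hL, hiL⟩ := List.mem_flatten.1 (hcov i hi)
      exact ⟨L.map f, List.mem_map_of_mem hL, List.mem_map_of_mem hiL⟩
    · simp only [List.forall_mem_map]
      intro L hL i hi j hj hij
      rcases hQ L hL i hi j hj with rfl | h | h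
      · exact hij.ne rfl
      · exact hij.2 (hE _ h)
      · exact hij.2 (hE _ h).symm
    · simp only [List.mem_toFinset, List.forall_mem_map]
      intro i hi
      obtain ⟨L, hL, hiL⟩ := List.mem_flatten.1 hi
      exact ⟨L.map f, List.mem_map_of_mem hL, List.mem_map_of_mem hiL⟩

end Refutation

/-- Two induced pentagons are not disjoint. -/
theorem not_inducedPentagon_of_disjoint {V : Type*} {G : SimpleGraph V} (hG : NordhausGaddumTight G)
    {a b c d e x y z u v : V} (h : InducedPentagon G a b c d e)
    (h' : InducedPentagon G x y z u v)
    (hnd : [a, b, c, d, e, x, y, z, u, v].Nodup) : False := by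
  refine Refutation.not_check hG (f := ![a, b, c, d, e, x, y, z, u, v])
    (List.nodup_ofFn.1 hnd)
    (.branch 0 5
      (.branch 0 6
        (.branch 1 5
          (.branch 1 6
            (.leaf [[0, 2], [1, 3], [5, 7], [6, 8]] [[0, 1, 5, 6], [2, 3], [7, 8]])
            (.branch 1 8
              (.branch 1 9
                (.leaf [[0, 2], [1, 3], [5, 8], [6, 9]] [[0, 5, 6], [1, 8, 9], [2, 3]])
                (.leaf [[0, 2], [1, 6, 9], [5, 8]] [[0, 5, 6], [1, 2], [8, 9]]))
              (.leaf [[0, 2], [1, 6, 8], [5, 7]] [[0, 5, 6], [1, 2], [7, 8]])))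
          (.branch 1 7
            (.branch 1 8
              (.leaf [[0, 2], [1, 3], [5, 7], [6, 8]] [[0, 5, 6], [1, 7, 8], [2, 3]])
              (.leaf [[0, 2], [1, 5, 8], [6, 9]] [[0, 5, 6], [1, 2], [8, 9]]))
            (.leaf [[0, 2], [1, 5, 7], [6, 8]] [[0, 5, 6], [1, 2], [7, 8]])))
        (.branch 1 5
          (.branch 2 6
            (.branch 3 6
              (.leaf [[0, 2], [1, 3], [5, 7], [6, 8]] [[0, 1, 5], [2, 3, 6], [7, 8]])
              (.leaf [[0, 3, 6], [1, 4], [5, 7]] [[0, 1, 5], [3, 4], [6, 7]]))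
            (.leaf [[0, 2, 6], [1, 3], [5, 7]] [[0, 1, 5], [2, 3], [6, 7]]))
          (.branch 0 9
            (.branch 1 7
              (.branch 1 8
                (.leaf [[0, 2], [1, 3], [5, 8], [7, 9]] [[0, 5, 9], [1, 7, 8], [2, 3]])
                (.leaf [[0, 2], [1, 5, 8], [7, 9]] [[0, 5, 9], [1, 2], [7, 8]]))
              (.leaf [[0, 2], [1, 5, 7], [6, 9]] [[0, 5, 9], [1, 2], [6, 7]]))
            (.branch 1 7
              (.branch 1 6
                (.leaf [[0, 6, 9], [1, 4], [5, 7]] [[0, 4], [1, 6, 7], [5, 9]])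
                (.branch 1 8
                  (.branch 0 7
                    (.branch 0 8
                      (.leaf [[0, 2], [1, 3], [5, 7], [6, 8]] [[0, 1, 7, 8], [2, 3], [5, 6]])
                      (.leaf [[0, 6, 8], [1, 4], [5, 7]] [[0, 4], [1, 7, 8], [5, 6]]))
                    (.leaf [[0, 7, 9], [1, 4], [5, 8]] [[0, 4], [1, 7, 8], [5, 9]]))
                  (.leaf [[0, 6, 9], [1, 5, 8]] [[0, 1], [5, 6], [8, 9]])))
              (.leaf [[0, 6, 9], [1, 5, 7]] [[0, 1], [5, 9], [6, 7]])))))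
      (.branch 0 7
        (.branch 1 7
          (.branch 2 5
            (.branch 3 5
              (.leaf [[0, 2], [1, 3], [5, 7]] [[0, 1, 7], [2, 3, 5]])
              (.leaf [[0, 3, 5], [1, 4], [7, 9]] [[0, 1, 7], [3, 4], [5, 9]]))
            (.leaf [[0, 2, 5], [1, 3], [7, 9]] [[0, 1, 7], [2, 3], [5, 9]]))
          (.branch 0 8
            (.branch 1 5
              (.branch 1 9
                (.leaf [[0, 2], [1, 3], [5, 8], [7, 9]] [[0, 7, 8], [1, 5, 9], [2, 3]])
                (.leaf [[0, 2], [1, 7, 9], [5, 8]] [[0, 7, 8], [1, 2], [5, 9]]))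
              (.leaf [[0, 2], [1, 5, 7], [6, 8]] [[0, 7, 8], [1, 2], [5, 6]]))
            (.branch 1 9
              (.branch 4 7
                (.leaf [[0, 5, 8], [1, 7], [2, 4], [6, 9]] [[0, 4, 7], [1, 2], [5, 6], [8, 9]])
                (.leaf [[0, 5, 8], [1, 4, 7], [6, 9]] [[0, 4], [1, 9], [5, 6], [7, 8]]))
              (.leaf [[0, 5, 8], [1, 7, 9]] [[0, 1], [5, 9], [7, 8]]))))
        (.branch 1 6
          (.branch 1 5
            (.leaf [[0, 5, 7], [1, 4], [6, 8]] [[0, 4], [1, 5, 6], [7, 8]])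
            (.branch 0 6
              (.branch 2 5
                (.leaf [[0, 5, 7], [1, 3], [2, 4], [6, 8]] [[0, 1, 6], [2, 5], [3, 4], [7, 8]])
                (.leaf [[0, 2, 5], [1, 3], [6, 9]] [[0, 1, 6], [2, 3], [5, 9]]))
              (.branch 1 7
                (.leaf [[0, 5, 7], [1, 4], [6, 9]] [[0, 4], [1, 6, 7], [5, 9]])
                (.branch 0 8
                  (.branch 0 9
                    (.branch 1 8
                      (.branch 1 9
                        (.leaf [[0, 2], [1, 3], [5, 8], [6, 9]] [[0, 1, 8, 9], [2, 3], [5, 6]])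
                        (.leaf [[0, 2], [1, 7, 9], [6, 8]] [[0, 8, 9], [1, 2], [6, 7]]))
                      (.leaf [[0, 2], [1, 5, 8], [6, 9]] [[0, 8, 9], [1, 2], [5, 6]]))
                    (.leaf [[0, 6, 9], [1, 5, 7]] [[0, 1], [5, 9], [6, 7]]))
                  (.leaf [[0, 6, 8], [1, 5, 7]] [[0, 1], [5, 6], [7, 8]])))))
          (.branch 1 8
            (.branch 1 7
              (.leaf [[0, 5, 7], [1, 4], [6, 8]] [[0, 4], [1, 7, 8], [5, 6]])
              (.branch 1 9
                (.branch 0 8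
                  (.branch 0 9
                    (.leaf [[0, 2], [1, 3], [5, 8], [6, 9]] [[0, 1, 8, 9], [2, 3], [5, 6]])
                    (.leaf [[0, 7, 9], [1, 4], [6, 8]] [[0, 4], [1, 8, 9], [6, 7]]))
                  (.leaf [[0, 5, 8], [1, 4], [6, 9]] [[0, 4], [1, 8, 9], [5, 6]]))
                (.leaf [[0, 5, 7], [1, 6, 9]] [[0, 1], [5, 9], [6, 7]])))
            (.leaf [[0, 5, 7], [1, 6, 8]] [[0, 1], [5, 6], [7, 8]])))))
    (E := [(0, 1), (1, 2), (2, 3), (3, 4), (4, 0),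
        (5, 6), (6, 7), (7, 8), (8, 9), (9, 5)])
    (N := [(0, 2), (1, 3), (2, 4), (3, 0), (4, 1),
        (5, 7), (6, 8), (7, 9), (8, 5), (9, 6)])
    ?_ ?_ (by decide)
  · simp [h.ab, h.bc, h.cd, h.de, h.ea, h'.ab, h'.bc, h'.cd, h'.de, h'.ea]
  · simp [h.nac, h.nbd, h.nce, h.nda, h.neb, h'.nac, h'.nbd, h'.nce, h'.nda, h'.neb]

/-- Two induced pentagons do not share exactly one vertex. -/
theorem not_inducedPentagon_of_common_vertex {V : Type*} {G : SimpleGraph V}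
    (hG : NordhausGaddumTight G)
    {a b c d e x y z u : V} (h : InducedPentagon G a b c d e)
    (h' : InducedPentagon G a x y z u)
    (hnd : [a, b, c, d, e, x, y, z, u].Nodup) : False := by
  refine Refutation.not_check hG (f := ![a, b, c, d, e, x, y, z, u])
    (List.nodup_ofFn.1 hnd)
    (.branch 1 5
      (.branch 2 6
        (.branch 2 7
          (.leaf [[0, 6], [1, 3], [2, 4], [5, 7]] [[0, 1, 5], [2, 6, 7], [3, 4]])
          (.leaf [[0, 2, 7], [1, 3], [5, 8]] [[0, 1, 5], [2, 3], [7, 8]]))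
        (.leaf [[0, 2, 6], [1, 3], [5, 7]] [[0, 1, 5], [2, 3], [6, 7]]))
      (.branch 1 8
        (.branch 2 6
          (.branch 2 7
            (.leaf [[0, 7], [1, 3], [2, 4], [6, 8]] [[0, 1, 8], [2, 6, 7], [3, 4]])
            (.leaf [[0, 2, 7], [1, 3], [6, 8]] [[0, 1, 8], [2, 3], [6, 7]]))
          (.leaf [[0, 2, 6], [1, 3], [5, 8]] [[0, 1, 8], [2, 3], [5, 6]]))
        (.branch 2 6
          (.branch 2 7
            (.branch 3 6
              (.branch 3 7
                (.branch 4 5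
                  (.leaf [[0, 3], [2, 4], [5, 7]] [[0, 4, 5], [2, 3, 7]])
                  (.branch 1 6
                    (.branch 1 7
                      (.leaf [[0, 6], [1, 3], [2, 4], [5, 7]] [[0, 5], [1, 2, 6, 7], [3, 4]])
                      (.leaf [[0, 2], [1, 5, 7], [6, 8]] [[0, 5], [1, 2, 6], [7, 8]]))
                    (.branch 2 5
                      (.leaf [[0, 2], [1, 6, 8], [5, 7]] [[0, 1], [2, 5, 6], [7, 8]])
                      (.leaf [[0, 3], [1, 6, 8], [2, 4, 5]] [[0, 8], [1, 2], [3, 4], [5, 6]]))))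
                (.leaf [[0, 3, 7], [1, 5, 8], [2, 4]] [[0, 5], [1, 2], [3, 4], [7, 8]]))
              (.leaf [[0, 3, 6], [2, 4], [5, 7]] [[0, 5], [2, 6, 7], [3, 4]]))
            (.leaf [[0, 2, 7], [1, 5, 8]] [[0, 5], [1, 2], [7, 8]]))
          (.leaf [[0, 2, 6], [1, 5, 8]] [[0, 8], [1, 2], [5, 6]]))))
    (E := [(0, 1), (1, 2), (2, 3), (3, 4), (4, 0),
        (0, 5), (5, 6), (6, 7), (7, 8), (8, 0)])
    (N := [(0, 2), (1, 3), (2, 4), (3, 0), (4, 1),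
        (0, 6), (5, 7), (6, 8), (7, 0), (8, 5)])
    ?_ ?_ (by decide)
  · simp [h.ab, h.bc, h.cd, h.de, h.ea, h'.ab, h'.bc, h'.cd, h'.de, h'.ea]
  · simp [h.nac, h.nbd, h.nce, h.nda, h.neb, h'.nac, h'.nbd, h'.nce, h'.nda, h'.neb]

/-- Two induced pentagons do not share exactly two adjacent vertices. -/
theorem not_inducedPentagon_of_common_edge {V : Type*} {G : SimpleGraph V}
    (hG : NordhausGaddumTight G)
    {a b c d e x y z : V} (h : InducedPentagon G a b c d e)
    (h' : InducedPentagon G a b x y z)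
    (hnd : [a, b, c, d, e, x, y, z].Nodup) : False := by
  refine Refutation.not_check hG (f := ![a, b, c, d, e, x, y, z])
    (List.nodup_ofFn.1 hnd)
    (.branch 2 5
      (.branch 2 6
        (.branch 3 5
          (.branch 3 6
            (.branch 3 7
              (.leaf [[0, 6], [1, 3], [2, 4], [5, 7]] [[0, 4], [1, 2, 5], [3, 6, 7]])
              (.leaf [[0, 5], [1, 3, 7], [2, 4]] [[0, 7], [1, 2, 5], [3, 4]]))
            (.leaf [[0, 5], [1, 3, 6], [2, 4]] [[0, 1], [2, 5, 6], [3, 4]]))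
          (.leaf [[0, 3, 5], [1, 6], [2, 4]] [[0, 1], [2, 5, 6], [3, 4]]))
        (.leaf [[0, 2, 6], [1, 4], [5, 7]] [[0, 4], [1, 2, 5], [6, 7]]))
      (.branch 3 6
        (.branch 3 7
          (.branch 2 6
            (.branch 2 7
              (.leaf [[0, 6], [1, 3], [2, 4], [5, 7]] [[0, 4], [1, 5], [2, 3, 6, 7]])
              (.leaf [[0, 6], [1, 3], [2, 5, 7]] [[0, 7], [1, 5], [2, 3, 6]]))
            (.branch 4 7
              (.leaf [[0, 2, 6], [1, 4], [5, 7]] [[0, 4, 7], [1, 2], [5, 6]])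
              (.leaf [[0, 2, 6], [1, 4, 7]] [[0, 4], [1, 2], [6, 7]])))
          (.leaf [[0, 2, 5], [1, 3, 7]] [[0, 7], [1, 5], [2, 3]]))
        (.leaf [[0, 2, 5], [1, 3, 6]] [[0, 1], [2, 3], [5, 6]])))
    (E := [(0, 1), (1, 2), (2, 3), (3, 4), (4, 0),
        (0, 1), (1, 5), (5, 6), (6, 7), (7, 0)])
    (N := [(0, 2), (1, 3), (2, 4), (3, 0), (4, 1),
        (0, 5), (1, 6), (5, 7), (6, 0), (7, 1)])
    ?_ ?_ (by decide)
  · simp [h.ab, h.bc, h.cd, h.de, h.ea, h'.bc, h'.cd, h'.de, h'.ea]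
  · simp [h.nac, h.nbd, h.nce, h.nda, h.neb, h'.nac, h'.nbd, h'.nce, h'.nda, h'.neb]

/-- Three consecutive vertices of an induced pentagon are not all exchangeable. -/
theorem not_inducedPentagon_of_three_swaps {V : Type*} {G : SimpleGraph V}
    (hG : NordhausGaddumTight G)
    {a b c d e x y z : V} (h : InducedPentagon G a b c d e) (hx : InducedPentagon G x b c d e)
    (hy : InducedPentagon G a y c d e) (hz : InducedPentagon G a b z d e)
    (hnd : [a, b, c, d, e, x, y, z].Nodup) : False := by
  refine Refutation.not_check hG (f := ![a, b, c, d, e, x, y, z])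
    (List.nodup_ofFn.1 hnd)
    (.branch 0 5
      (.branch 1 6
        (.leaf [[0, 7], [1, 4], [2, 5], [3, 6]] [[0, 4, 5], [1, 2, 6], [3, 7]])
        (.leaf [[0, 3], [1, 4, 6], [2, 5]] [[0, 1, 5], [2, 6], [3, 4]]))
      (.branch 1 6
        (.leaf [[0, 2, 5], [1, 4], [3, 6]] [[0, 1, 6], [2, 3], [4, 5]])
        (.leaf [[0, 2, 5], [1, 3, 6]] [[0, 6], [1, 5], [2, 3]])))
    (E := [(0, 1), (1, 2), (2, 3), (3, 4), (4, 0), (5, 1), (4, 5), (0, 6), (6, 2), (1, 7), (7, 3)])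
    (N := [(0, 2), (1, 3), (2, 4), (3, 0), (4, 1), (5, 2), (3, 5), (6, 3), (4, 6), (0, 7), (7, 4)])
    ?_ ?_ (by decide)
  · simp [h.ab, h.bc, h.cd, h.de, h.ea, hx.ab, hx.ea, hy.ab, hy.bc, hz.bc, hz.cd]
  · simp [h.nac, h.nbd, h.nce, h.nda, h.neb, hx.nac, hx.nda, hy.nbd, hy.neb, hz.nac, hz.nce]

theorem nodup_of_subset_toFinset {α : Type*} [DecidableEq α] {s : Finset α} {l : List α}
    (hs : s ⊆ l.toFinset) (h : l.length ≤ s.card) : l.Nodup :=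
  Multiset.toFinset_card_eq_card_iff_nodup.1
    ((List.toFinset_card_le l).antisymm (h.trans (Finset.card_le_card hs)))

section

variable {V : Type*} [DecidableEq V] {G : SimpleGraph V}

namespace IsPentagon

theorem card_union_add_card_inter {C D : Finset V} (hC : IsPentagon G C) (hD : IsPentagon G D) :
    (C ∪ D).card + (C ∩ D).card = 10 := by
  rw [Finset.card_union_add_card_inter, hC.card_eq, hD.card_eq]

theorem inter_ne_of_adj (hG : NordhausGaddumTight G) {C D : Finset V} (hC : IsPentagon G C)
    (hD : IsPentagon G D) {v w : V} (hvw : G.Adj v w) : C ∩ D ≠ {v, w} := by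
  intro h
  have hcard := hC.card_union_add_card_inter hD
  rw [h, Finset.card_pair hvw.ne] at hcard
  have hv : v ∈ C ∩ D := by simp [h]
  have hw : w ∈ C ∩ D := by simp [h]
  rw [Finset.mem_inter] at hv hw
  obtain ⟨a, b, c, hp, rfl⟩ := hC.exists_of_adj hv.1 hw.1 hvw
  obtain ⟨x, y, z, hq, rfl⟩ := hD.exists_of_adj hv.2 hw.2 hvw
  refine not_inducedPentagon_of_common_edge hG hp hq (nodup_of_subset_toFinset
    (s := {v, w, a, b, c} ∪ {v, w, x, y, z}) ?_
      (by simp only [List.length_cons, List.length_nil]; lia))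
  intro u
  simp only [List.mem_toFinset, Finset.mem_union, Finset.mem_insert, Finset.mem_singleton,
    List.mem_cons, List.not_mem_nil]
  tauto

theorem three_le_card_inter (hG : NordhausGaddumTight G) {C D : Finset V} (hC : IsPentagon G C)
    (hD : IsPentagon G D) : 3 ≤ (C ∩ D).card := by
  by_contra! hlt
  have hcard := hC.card_union_add_card_inter hD
  obtain h0 | h1 | h2 : (C ∩ D).card = 0 ∨ (C ∩ D).card = 1 ∨ (C ∩ D).card = 2 := by lia
  · obtain ⟨a, b, c, d, e, hp, rfl⟩ := hC
    obtain ⟨x, y, z, u, v, hq, rfl⟩ := hD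
    refine not_inducedPentagon_of_disjoint hG hp hq (nodup_of_subset_toFinset
      (s := {a, b, c, d, e} ∪ {x, y, z, u, v}) ?_
      (by simp only [List.length_cons, List.length_nil]; lia))
    intro w
    simp only [List.mem_toFinset, Finset.mem_union, Finset.mem_insert, Finset.mem_singleton,
      List.mem_cons, List.not_mem_nil]
    grind
  · obtain ⟨v, hv⟩ := Finset.card_eq_one.1 h1
    have hvCD : v ∈ C ∩ D := by simp [hv]
    rw [Finset.mem_inter] at hvCD
    obtain ⟨a, b, c, d, hp, rfl⟩ := hC.exists_of_mem hvCD.1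
    obtain ⟨x, y, z, u, hq, rfl⟩ := hD.exists_of_mem hvCD.2
    refine not_inducedPentagon_of_common_vertex hG hp hq (nodup_of_subset_toFinset
      (s := {v, a, b, c, d} ∪ {v, x, y, z, u}) ?_
      (by simp only [List.length_cons, List.length_nil]; lia))
    intro w
    simp only [List.mem_toFinset, Finset.mem_union, Finset.mem_insert, Finset.mem_singleton,
      List.mem_cons, List.not_mem_nil]
    grind
  · obtain ⟨v, w, hvw, h⟩ := Finset.card_eq_two.1 h2
    by_cases hadj : G.Adj v w
    · exact inter_ne_of_adj hG hC hD hadj h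
    · exact inter_ne_of_adj hG.compl hC.compl hD.compl ⟨hvw, hadj⟩ h

theorem mem_or_mem (hG : NordhausGaddumTight G) {C D : Finset V} (hC : IsPentagon G C)
    (hD : IsPentagon G D) {u v w : V} (hu : u ∈ C) (hv : v ∈ C) (hw : w ∈ C) (huv : u ≠ v)
    (huw : u ≠ w) (hvw : v ≠ w) (huD : u ∉ D) : v ∈ D ∨ w ∈ D := by
  by_contra! h
  have h3 := hC.three_le_card_inter hG hD
  have hsub : C ∩ D ⊆ C \ {u, v, w} := by
    intro x
    simp only [Finset.mem_inter, Finset.mem_sdiff, Finset.mem_insert, Finset.mem_singleton]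
    rintro ⟨hx, hxD⟩
    refine ⟨hx, ?_⟩
    rintro (rfl | rfl | rfl)
    exacts [huD hxD, h.1 hxD, h.2 hxD]
  have hle := Finset.card_le_card hsub
  rw [Finset.card_sdiff_of_subset (by simp [Finset.insert_subset_iff, hu, hv, hw]), hC.card_eq,
    Finset.card_eq_three.2 ⟨u, v, w, huv, huw, hvw, rfl⟩] at hle
  lia

theorem not_triangle_compl {t : Finset V} (h : IsPentagon G t) {x y z : V} (hx : x ∈ t)
    (hy : y ∈ t) (hz : z ∈ t) (hxy : x ≠ y) (hxz : x ≠ z) (hyz : y ≠ z) (nxy : ¬G.Adj x y)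
    (nxz : ¬G.Adj x z) (nyz : ¬G.Adj y z) : False :=
  h.compl.not_triangle hx hy hz ⟨hxy, nxy⟩ ⟨hxz, nxz⟩ ⟨hyz, nyz⟩

end IsPentagon

namespace InducedPentagon

theorem isPentagon {a b c d e : V} (h : InducedPentagon G a b c d e) :
    IsPentagon G {a, b, c, d, e} :=
  ⟨a, b, c, d, e, h, rfl⟩

/-- An induced pentagon missing only `a` of a given one replaces `a` by a new vertex. -/
theorem exists_twin {a b c d e : V} {D : Finset V} (h : InducedPentagon G a b c d e)
    (hD : IsPentagon G D) (hsd : {a, b, c, d, e} \ D = {a}) :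
    ∃ x ∉ ({a, b, c, d, e} : Finset V), InducedPentagon G x b c d e := by
  have hnd := h.nodup
  simp only [List.nodup_cons, List.mem_cons, List.not_mem_nil, or_false, not_or] at hnd
  have hmem : ∀ x ∈ ({a, b, c, d, e} : Finset V), x ≠ a → x ∈ D := by
    intro x hx hxa
    by_contra hxD
    exact hxa (Finset.mem_singleton.1 (hsd ▸ Finset.mem_sdiff.2 ⟨hx, hxD⟩))
  have haD : a ∉ D := (Finset.mem_sdiff.1 (hsd ▸ Finset.mem_singleton_self a)).2
  have hb : b ∈ D := hmem b (by simp) (Ne.symm hnd.1.1)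
  have hc : c ∈ D := hmem c (by simp) (Ne.symm hnd.1.2.1)
  have hd : d ∈ D := hmem d (by simp) (Ne.symm hnd.1.2.2.1)
  have he : e ∈ D := hmem e (by simp) (Ne.symm hnd.1.2.2.2)
  obtain ⟨u, v, w, hq, rfl⟩ := hD.exists_of_adj hb hc h.bc
  simp only [Finset.mem_insert, Finset.mem_singleton] at hd he
  obtain rfl : d = u := by
    rcases hd with rfl | rfl | rfl | rfl | rfl
    · simp_all
    · simp_all
    · rfl
    · exact absurd h.cd hq.nbd
    · exact absurd h.cd.symm hq.neb
  obtain rfl : e = v := by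
    rcases he with rfl | rfl | rfl | rfl | rfl
    · simp_all
    · simp_all
    · simp_all
    · rfl
    · exact absurd h.de hq.nce
  have hq' := hq.rotate.rotate.rotate.rotate
  refine ⟨w, ?_, hq'⟩
  have := hq'.nodup
  simp only [Finset.mem_insert, Finset.mem_singleton, not_or]
  simp only [List.nodup_cons, List.mem_cons, List.not_mem_nil, or_false, not_or] at this
  refine ⟨?_, this.1⟩
  rintro rfl
  simp at haD

/-- Some vertex of an induced pentagon is not exchangeable. -/
theorem _root_.IsPentagon.exists_not_swap (hG : NordhausGaddumTight G) {C : Finset V}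
    (hC : IsPentagon G C) :
    ∃ c ∈ C, ∀ D, IsPentagon G D → C \ D ≠ {c} := by
  obtain ⟨a, b, c, d, e, h, rfl⟩ := hC
  by_contra! hall
  obtain ⟨D₁, hD₁, h₁⟩ := hall a (by simp)
  obtain ⟨D₂, hD₂, h₂⟩ := hall b (by simp)
  obtain ⟨D₃, hD₃, h₃⟩ := hall c (by simp)
  obtain ⟨x, hx, hpx⟩ := h.exists_twin hD₁ h₁
  have e₂ : ({b, c, d, e, a} : Finset V) = {a, b, c, d, e} := by
    ext; simp only [Finset.mem_insert, Finset.mem_singleton]; tauto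
  have e₃ : ({c, d, e, a, b} : Finset V) = {a, b, c, d, e} := by
    ext; simp only [Finset.mem_insert, Finset.mem_singleton]; tauto
  obtain ⟨y, hy, hpy⟩ := h.rotate.exists_twin hD₂ (e₂ ▸ h₂)
  obtain ⟨z, hz, hpz⟩ := h.rotate.rotate.exists_twin hD₃ (e₃ ▸ h₃)
  rw [e₂] at hy
  rw [e₃] at hz
  have hpy' := hpy.rotate.rotate.rotate.rotate
  have hpz' := hpz.rotate.rotate.rotate
  refine not_inducedPentagon_of_three_swaps hG h hpx hpy' hpz' ?_
  have hxy : x ≠ y := by rintro rfl; exact hpx.nac hpy'.bc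
  have hxz : x ≠ z := by rintro rfl; exact hpx.nda hpz'.cd.symm
  have hyz : y ≠ z := by rintro rfl; exact hpz'.nac hpy'.ab
  have := h.nodup
  simp only [Finset.mem_insert, Finset.mem_singleton, not_or] at hx hy hz
  simp only [List.nodup_cons, List.mem_cons, List.not_mem_nil, or_false, not_or] at this ⊢
  grind

end InducedPentagon

end

/-- The possible adjacencies between the private vertices of two induced pentagons that share three
consecutive vertices. -/
theorem adj_cases_of_common_path {V : Type*} {G : SimpleGraph V} (hG : NordhausGaddumTight G)
    {a b r q p x y : V} (h : InducedPentagon G a b r q p) (h' : InducedPentagon G q r y x p)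
    (hnd : [a, b, r, q, p, x, y].Nodup) :
    (G.Adj a y ∧ G.Adj b x) ∨
      (¬G.Adj a x ∧ ¬G.Adj a y ∧ ¬G.Adj b x ∧ G.Adj b y) ∨
      (G.Adj a x ∧ ¬G.Adj a y ∧ ¬G.Adj b x ∧ ¬G.Adj b y) := by
  have key : ∀ (P Q : List (List (Fin 7))) (E N : List (Fin 7 × Fin 7)),
      (∀ e ∈ E, G.Adj (![a, b, r, q, p, x, y] e.1) (![a, b, r, q, p, x, y] e.2)) →
      (∀ e ∈ N, ¬G.Adj (![a, b, r, q, p, x, y] e.1) (![a, b, r, q, p, x, y] e.2)) →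
      ¬(Refutation.leaf P Q).check
        ([(0, 1), (1, 2), (2, 3), (3, 4), (4, 0), (2, 6), (6, 5), (5, 4)] ++ E)
        ([(0, 2), (1, 3), (2, 4), (3, 0), (4, 1), (3, 6), (2, 5), (6, 4), (5, 3)] ++ N) := by
    intro P Q E N hE hN
    refine Refutation.not_check hG (f := ![a, b, r, q, p, x, y]) (List.nodup_ofFn.1 hnd) _
      (List.forall_mem_append.2 ⟨?_, hE⟩) (List.forall_mem_append.2 ⟨?_, hN⟩)
    · simp [h.ab, h.bc, h.cd, h.de, h.ea, h'.bc, h'.cd, h'.de]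
    · simp [h.nac, h.nbd, h.nce, h.nda, h.neb, h'.nac, h'.nbd, h'.nce, h'.nda]
  by_cases hax : G.Adj a x <;> by_cases hby : G.Adj b y
  · by_cases hay : G.Adj a y
    · by_cases hbx : G.Adj b x
      · exact .inl ⟨hay, hbx⟩
      · exact (key [[0, 2], [1, 5], [4, 6]] [[0, 4, 5], [1, 2, 6]] [(0, 5), (1, 6)] [(1, 5)]
          (by simp [hax, hby]) (by simp [hbx]) (by decide)).elim
    · exact (key [[0, 6], [1, 4], [2, 5]] [[0, 4, 5], [1, 2, 6]] [(0, 5), (1, 6)] [(0, 6)]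
        (by simp [hax, hby]) (by simp [hay]) (by decide)).elim
  · by_cases hay : G.Adj a y
    · exact (key [[0, 3], [1, 4, 6], [2, 5]] [[0, 5, 6], [1, 2], [3, 4]] [(0, 5), (0, 6)] [(1, 6)]
        (by simp [hax, hay]) (by simp [hby]) (by decide)).elim
    · by_cases hbx : G.Adj b x
      · exact (key [[0, 3], [1, 4, 6], [2, 5]] [[0, 1, 5], [2, 6], [3, 4]] [(0, 5), (1, 5)]
          [(1, 6)] (by simp [hax, hbx]) (by simp [hby]) (by decide)).elim
      · exact .inr (.inr ⟨hax, hay, hbx, hby⟩)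
  · by_cases hay : G.Adj a y
    · exact (key [[0, 2, 5], [1, 4], [3, 6]] [[0, 1, 6], [2, 3], [4, 5]] [(0, 6), (1, 6)] [(0, 5)]
        (by simp [hay, hby]) (by simp [hax]) (by decide)).elim
    · by_cases hbx : G.Adj b x
      · exact (key [[0, 2, 5], [1, 4], [3, 6]] [[0, 4], [1, 5, 6], [2, 3]] [(1, 5), (1, 6)]
          [(0, 5)] (by simp [hbx, hby]) (by simp [hax]) (by decide)).elim
      · exact .inr (.inl ⟨hax, hay, hbx, hby⟩)
  · exact (key [[0, 2, 5], [1, 3, 6]] [[0, 1], [2, 3], [5, 6]] [] [(0, 5), (1, 6)]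
      (by simp) (by simp [hax, hby]) (by decide)).elim

section

variable {V : Type*} [DecidableEq V] {G : SimpleGraph V}

/-- If `p` together with any two of the edges `ab`, `rq`, `xy` spans an induced pentagon, then every
induced pentagon contains `p`. -/
theorem IsPentagon.mem_of_three_inducedPentagon (hG : NordhausGaddumTight G) {a b r q p x y : V}
    (h : InducedPentagon G a b r q p) (h' : InducedPentagon G q r y x p)
    (h'' : InducedPentagon G p a b y x) (hnd : [a, b, r, q, p, x, y].Nodup) {E : Finset V}
    (hE : IsPentagon G E) : p ∈ E := by
  by_contra hp
  simp only [List.nodup_cons, List.mem_cons, List.not_mem_nil, or_false, not_or] at hnd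
  obtain ⟨⟨hab, har, haq, hap, hax, hay⟩, ⟨hbr, hbq, hbp, hbx, hby⟩, ⟨hrq, hrp, hrx, hry⟩,
    ⟨hqp, hqx, hqy⟩, ⟨hpx, hpy⟩, hxy, -⟩ := hnd
  have hrq' := h.isPentagon.mem_or_mem hG hE (u := p) (v := r) (w := q) (by simp) (by simp)
    (by simp) (Ne.symm hrp) (Ne.symm hqp) hrq hp
  have hra' := h.isPentagon.mem_or_mem hG hE (u := p) (v := r) (w := a) (by simp) (by simp)
    (by simp) (Ne.symm hrp) (Ne.symm hap) (Ne.symm har) hp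
  have hrx' := h'.isPentagon.mem_or_mem hG hE (u := p) (v := r) (w := x) (by simp) (by simp)
    (by simp) (Ne.symm hrp) hpx hrx hp
  have hbq' := h.isPentagon.mem_or_mem hG hE (u := p) (v := b) (w := q) (by simp) (by simp)
    (by simp) (Ne.symm hbp) (Ne.symm hqp) hbq hp
  have hba' := h.isPentagon.mem_or_mem hG hE (u := p) (v := b) (w := a) (by simp) (by simp)
    (by simp) (Ne.symm hbp) (Ne.symm hap) (Ne.symm hab) hp
  have hbx' := h''.isPentagon.mem_or_mem hG hE (u := p) (v := b) (w := x) (by simp) (by simp)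
    (by simp) (Ne.symm hbp) hpx hbx hp
  have hyq' := h'.isPentagon.mem_or_mem hG hE (u := p) (v := y) (w := q) (by simp) (by simp)
    (by simp) hpy (Ne.symm hqp) (Ne.symm hqy) hp
  have hya' := h''.isPentagon.mem_or_mem hG hE (u := p) (v := y) (w := a) (by simp) (by simp)
    (by simp) hpy (Ne.symm hap) (Ne.symm hay) hp
  have hyx' := h'.isPentagon.mem_or_mem hG hE (u := p) (v := y) (w := x) (by simp) (by simp)
    (by simp) hpy hpx (Ne.symm hxy) hp
  have hind : ¬(q ∈ E ∧ a ∈ E ∧ x ∈ E) := fun k =>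
    hE.not_triangle_compl k.1 k.2.1 k.2.2 (Ne.symm haq) hqx hax h.nda
      (fun k => h'.nda k.symm) (fun k => h''.neb k.symm)
  by_cases hrE : r ∈ E
  · by_cases hbE : b ∈ E
    · by_cases hyE : y ∈ E
      · exact hE.not_triangle hrE hbE hyE h.bc.symm h'.bc h''.cd
      · exact hind ⟨hyq'.resolve_left hyE, hya'.resolve_left hyE, hyx'.resolve_left hyE⟩
    · exact hind ⟨hbq'.resolve_left hbE, hba'.resolve_left hbE, hbx'.resolve_left hbE⟩
  · exact hind ⟨hrq'.resolve_left hrE, hra'.resolve_left hrE, hrx'.resolve_left hrE⟩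

/-- Two induced pentagons that share three vertices either admit single-vertex exchanges for each
vertex of their difference, or all induced pentagons have a common vertex. -/
theorem IsPentagon.swap_or_common_of_adj (hG : NordhausGaddumTight G) {C D : Finset V}
    (hC : IsPentagon G C) (hD : IsPentagon G D) {a b : V} (hCD : C \ D = {a, b})
    (hab : G.Adj a b) :
    (∀ c ∈ C \ D, ∃ D', IsPentagon G D' ∧ C \ D' = {c}) ∨ ∃ e, ∀ E, IsPentagon G E → e ∈ E := by
  have ha : a ∈ C \ D := by simp [hCD]
  have hb : b ∈ C \ D := by simp [hCD]
  rw [Finset.mem_sdiff] at ha hb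
  obtain ⟨r, q, p, h, rfl⟩ := hC.exists_of_adj ha.1 hb.1 hab
  have hndC := h.nodup
  simp only [List.nodup_cons, List.mem_cons, List.not_mem_nil, or_false, not_or] at hndC
  have hmem : ∀ z ∈ ({a, b, r, q, p} : Finset V), z ≠ a → z ≠ b → z ∈ D := by
    intro z hz hza hzb
    by_contra hzD
    have : z ∈ ({a, b} : Finset V) := hCD ▸ Finset.mem_sdiff.2 ⟨hz, hzD⟩
    simp [hza, hzb] at this
  have hr : r ∈ D := hmem r (by simp) (Ne.symm hndC.1.2.1) (Ne.symm hndC.2.1.1)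
  have hq : q ∈ D := hmem q (by simp) (Ne.symm hndC.1.2.2.1) (Ne.symm hndC.2.1.2.1)
  have hp : p ∈ D := hmem p (by simp) (Ne.symm hndC.1.2.2.2) (Ne.symm hndC.2.1.2.2)
  obtain ⟨y, x, p', h', rfl⟩ := hD.exists_of_adj hq hr h.cd.symm
  obtain rfl : p = p' := by
    simp only [Finset.mem_insert, Finset.mem_singleton] at hp
    rcases hp with rfl | rfl | rfl | rfl | rfl
    · simp_all
    · simp_all
    · exact absurd h.de h'.nac
    · exact absurd h.de.symm h'.nda
    · rfl
  have hnd : [a, b, r, q, p, x, y].Nodup := by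
    have := h'.nodup
    simp only [Finset.mem_insert, Finset.mem_singleton, not_or] at ha hb
    simp only [List.nodup_cons, List.mem_cons, List.not_mem_nil, or_false, not_or] at this ⊢
    grind
  have hnd' := hnd
  simp only [List.nodup_cons, List.mem_cons, List.not_mem_nil, or_false, not_or] at hnd'
  rcases adj_cases_of_common_path hG h h' hnd with ⟨hay, hbx⟩ | ⟨hax, hay, hbx, hby⟩ |
    ⟨hax, hay, hbx, hby⟩
  · left
    have h₁ : InducedPentagon G x b r q p :=
      ⟨hbx.symm, h.bc, h.cd, h.de, h'.de.symm, fun k => h'.nbd k.symm, h.nbd, h.nce,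
        fun k => h'.nda k.symm, h.neb⟩
    have h₂ : InducedPentagon G a y r q p :=
      ⟨hay, h'.bc.symm, h.cd, h.de, h.ea, h.nac, fun k => h'.nac k.symm, h.nce, h.nda,
        fun k => h'.nce k.symm⟩
    rw [hCD]
    intro c hc
    rcases Finset.mem_insert.1 hc with rfl | hc
    · refine ⟨_, h₁.isPentagon, ?_⟩
      ext z
      simp only [Finset.mem_sdiff, Finset.mem_insert, Finset.mem_singleton]
      grind
    · obtain rfl := Finset.mem_singleton.1 hc
      refine ⟨_, h₂.isPentagon, ?_⟩
      ext z
      simp only [Finset.mem_sdiff, Finset.mem_insert, Finset.mem_singleton]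
      grind
  · refine .inr ⟨p, fun E hE => hE.mem_of_three_inducedPentagon hG h h'
      ⟨h.ea, hab, hby, h'.cd, h'.de, fun k => h.neb k, hay, hbx, ?_, ?_⟩ hnd⟩
    · exact fun k => h'.nce k
    · exact fun k => hax k.symm
  · have hh : InducedPentagon G b a p q r := h.reverse.rotate.rotate.rotate.rotate
    refine .inr ⟨r, fun E hE => hE.mem_of_three_inducedPentagon hG hh h'.reverse
      ⟨h.bc.symm, hab.symm, hax, h'.cd.symm, h'.bc.symm, fun k => h.nac k.symm, hbx, hay, ?_, ?_⟩
      ?_⟩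
    · exact fun k => h'.nbd k.symm
    · exact fun k => hby k.symm
    · simp only [List.nodup_cons, List.mem_cons, List.not_mem_nil, or_false, not_or]
      grind

end

/-- A nonempty `1`-HNG graph is apex-perfect: some vertex deletion leaves a
perfect graph. -/
theorem stmt_12 {V : Type*} [Fintype V] [DecidableEq V] (G : SimpleGraph V)
    [Nonempty V] (hG : IsHNG G 1) :
    ∃ v : V, IsPerfect (G.induce ({v}ᶜ : Set V)) := by
  have hT := hG.nordhausGaddumTight
  by_contra! hno
  have hav : ∀ v, ∃ D, IsPentagon G D ∧ v ∉ D := by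
    intro v
    by_contra! hv
    refine hno v (isPerfect_induce_of_goodOn v fun s hs => ?_)
    by_contra hbad
    obtain ⟨u, hu, hpu⟩ := exists_isPentagon_of_not_goodOn hT hbad
    exact hs (hu (hv u hpu))
  obtain ⟨C, hC, -⟩ := hav (Classical.arbitrary V)
  obtain ⟨c, hc, hcC⟩ := hC.exists_not_swap hT
  obtain ⟨D, hD, hcD⟩ := hav c
  have h3 := hC.three_le_card_inter hT hD
  have hsum := Finset.card_sdiff_add_card_inter C D
  rw [hC.card_eq] at hsum
  have hcm : c ∈ C \ D := Finset.mem_sdiff.2 ⟨hc, hcD⟩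
  have hpos := Finset.card_pos.2 ⟨c, hcm⟩
  obtain h1 | h2 : (C \ D).card = 1 ∨ (C \ D).card = 2 := by lia
  · obtain ⟨z, hz⟩ := Finset.card_eq_one.1 h1
    rw [hz, Finset.mem_singleton] at hcm
    exact hcC D hD (hcm ▸ hz)
  · obtain ⟨a, b, hab, hCD⟩ := Finset.card_eq_two.1 h2
    have hor : (∀ c ∈ C \ D, ∃ D', IsPentagon G D' ∧ C \ D' = {c}) ∨
        ∃ e, ∀ E, IsPentagon G E → e ∈ E := by
      by_cases hadj : G.Adj a b
      · exact hC.swap_or_common_of_adj hT hD hCD hadj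
      · simpa only [IsPentagon.compl_iff] using
          hC.compl.swap_or_common_of_adj hT.compl hD.compl hCD ⟨hab, hadj⟩
    obtain h | ⟨e, he⟩ := hor
    · obtain ⟨D', hD', hsd⟩ := h c hcm
      exact hcC D' hD' hsd
    · obtain ⟨E, hE, heE⟩ := hav e
      exact heE (he E hE)
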